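/- Let X be a finite set of n ≥ 3 points in ℝ² in general position, let d ≥ 2 be an integer, and suppose X is contained in a Jordan curve with stabbing number at most d. Then there exists an enumeration x₁, x₂, …, xₙ of the points of X such that the closed polygonal curve consisting of the segments x₁x₂, x₂x₃, …, xₙ₋₁xₙ, xₙx₁ is a Jordan curve with stabbing number at most d. -/

import Mathlib

open Set

/-- Points of the plane. -/
abbrev Pt := ℝ × ℝ

/-- An affine line in ℝ², given by a nontrivial linear equation. -/
def IsAffLine (l : Set Pt) : Prop :=
  ∃ a b c : ℝ, (a ≠ 0 ∨ b ≠ 0) ∧ l = {p : Pt | a * p.1 + b * p.2 = c}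

/-- An open half-plane in ℝ². -/
def IsOpenHalfPlane (H : Set Pt) : Prop :=
  ∃ a b c : ℝ, (a ≠ 0 ∨ b ≠ 0) ∧ H = {p : Pt | a * p.1 + b * p.2 < c}

/-- `A` and `B` are linearly separable: some affine line has `A` strictly on
one side and `B` strictly on the other side. -/
def LinSep (A B : Set Pt) : Prop :=
  ∃ a b c : ℝ, (a ≠ 0 ∨ b ≠ 0) ∧ (∀ p ∈ A, a * p.1 + b * p.2 < c) ∧
    (∀ p ∈ B, c < a * p.1 + b * p.2)

/-- General position: no three (distinct) points of `X` are collinear. -/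
def GenPos (X : Set Pt) : Prop :=
  ∀ p ∈ X, ∀ q ∈ X, ∀ r ∈ X, p ≠ q → p ≠ r → q ≠ r →
    ¬ Collinear ℝ ({p, q, r} : Set Pt)

/-- Convex position: no point of `X` lies in the convex hull of the others. -/
def ConvexPos (X : Set Pt) : Prop :=
  ∀ p ∈ X, p ∉ convexHull ℝ (X \ {p})

/-- A cell of an arrangement `L` of lines: a connected component of the
complement of the union of the lines. -/
def IsCell (L : Set (Set Pt)) (cell : Set Pt) : Prop :=
  ∃ p ∈ (⋃₀ L)ᶜ, cell = connectedComponentIn (⋃₀ L)ᶜ p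

/-- `S` has at most `d` connected components: among any `d + 1` points of `S`,
two lie in the same connected component of `S`. -/
def CompsLE (S : Set Pt) (d : ℕ) : Prop :=
  ∀ f : Fin (d + 1) → Pt, (∀ i, f i ∈ S) →
    ∃ i j, i ≠ j ∧ connectedComponentIn S (f i) = connectedComponentIn S (f j)

/-- A Jordan curve: the image of a continuous injective map from the unit
circle to the plane. -/
def IsJordanCurve (J : Set Pt) : Prop :=
  ∃ f : EuclideanSpace ℝ (Fin 2) → Pt,
    ContinuousOn f (Metric.sphere 0 1) ∧ Set.InjOn f (Metric.sphere 0 1) ∧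
      J = f '' (Metric.sphere 0 1)

/-- `J` has stabbing number at most `d` (a natural number): every affine line
meets `J` in at most `d` connected components. -/
def StabLE (J : Set Pt) (d : ℕ) : Prop :=
  ∀ l, IsAffLine l → CompsLE (J ∩ l) d

/-- `J` has stabbing number at most a real number `d`: every affine line meets
`J` in at most `⌊d⌋₊` connected components. -/
def StabLER (J : Set Pt) (d : ℝ) : Prop :=
  ∀ l, IsAffLine l → CompsLE (J ∩ l) ⌊d⌋₊


lemma jordan_iff (T : ℝ) (hT : 0 < T) (J : Set Pt) :
    IsJordanCurve J ↔ ∃ G : AddCircle T → Pt, Continuous G ∧ Function.Injective G ∧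
      J = Set.range G := by
  let H0 : Circle ≃ₜ Metric.sphere (0 : EuclideanSpace ℝ (Fin 2)) 1 :=
    Complex.orthonormalBasisOneI.repr.toHomeomorph.subtype (by
      intro z
      simp [Submonoid.unitSphere])
  let H : AddCircle T ≃ₜ Metric.sphere (0 : EuclideanSpace ℝ (Fin 2)) 1 :=
    (AddCircle.homeomorphCircle hT.ne').trans H0
  constructor
  · rintro ⟨f, hf, hi, rfl⟩
    refine ⟨fun t => f (H t), ?_, ?_, ?_⟩
    · exact (continuousOn_iff_continuous_domRestrict.1 hf).comp H.continuous
    · intro s t hst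
      have := hi (H s).2 (H t).2 hst
      exact H.injective (Subtype.ext this)
    · ext p
      constructor
      · rintro ⟨v, hv, rfl⟩
        exact ⟨H.symm ⟨v, hv⟩, by simp⟩
      · rintro ⟨t, rfl⟩
        exact ⟨H t, (H t).2, rfl⟩
  · rintro ⟨G, hG, hi, rfl⟩
    classical
    refine ⟨fun v => if h : v ∈ Metric.sphere (0 : EuclideanSpace ℝ (Fin 2)) 1 then
      G (H.symm ⟨v, h⟩) else 0, ?_, ?_, ?_⟩
    · rw [continuousOn_iff_continuous_domRestrict]
      refine (hG.comp H.symm.continuous).congr ?_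
      intro v
      have := v.2
      simp only [Set.domRestrict_apply, Function.comp]
      rw [dif_pos this]
    · intro v hv w hw hvw
      simp only [dif_pos hv, dif_pos hw] at hvw
      have := H.symm.injective (hi hvw)
      exact congrArg Subtype.val this
    · ext p
      constructor
      · rintro ⟨t, rfl⟩
        refine ⟨H t, (H t).2, ?_⟩
        simp only [dif_pos (H t).2]
        simp
      · rintro ⟨v, hv, rfl⟩
        simp only [dif_pos hv]
        exact ⟨_, rfl⟩

lemma locFin : LocallyFinite (fun k : ℤ => Set.Icc (k : ℝ) (k + 1)) := by
  intro t
  refine ⟨Set.Ioo (t - 1) (t + 1), Ioo_mem_nhds (by linarith) (by linarith), ?_⟩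
  refine (Set.finite_Icc (⌊t⌋ - 2) (⌊t⌋ + 2)).subset ?_
  rintro k ⟨s, ⟨h1, h2⟩, h3, h4⟩
  have ha := Int.floor_le t
  have hb := Int.lt_floor_add_one t
  constructor
  · have : ((⌊t⌋ - 2 : ℤ) : ℝ) < ((k + 1 : ℤ) : ℝ) := by push_cast; linarith
    have := Int.cast_lt.1 this
    omega
  · have : (k : ℝ) < ((⌊t⌋ + 2 : ℤ) : ℝ) := by push_cast; linarith
    have := Int.cast_lt.1 this
    omega

/-- Polygons whose half-open edges are pairwise disjoint are Jordan curves. -/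
lemma poly_jordan (n : ℕ) (hn : 3 ≤ n) (x : ZMod n → Pt)
    (hx : ∀ i j : ZMod n, i ≠ j → ∀ s t : ℝ, 0 ≤ s → s < 1 → 0 ≤ t → t < 1 →
      AffineMap.lineMap (x i) (x (i + 1)) s ≠ AffineMap.lineMap (x j) (x (j + 1)) t)
    (hinj : Function.Injective x) :
    IsJordanCurve (⋃ i : ZMod n, segment ℝ (x i) (x (i + 1))) := by
  have : NeZero n := ⟨by omega⟩
  have hn0 : (0 : ℝ) < n := by exact_mod_cast (by omega : 0 < n)
  rw [jordan_iff n hn0]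
  let g : ℝ → Pt := fun t =>
    AffineMap.lineMap (x (⌊t⌋ : ZMod n)) (x ((⌊t⌋ : ZMod n) + 1)) (Int.fract t)
  have hper : Function.Periodic g (n : ℝ) := by
    intro t
    simp only [g]
    rw [Int.floor_add_natCast, Int.fract_add_natCast]
    simp
  have hIcc : ∀ k : ℤ, ∀ t ∈ Set.Icc (k : ℝ) (k + 1),
      g t = AffineMap.lineMap (x (k : ZMod n)) (x ((k : ZMod n) + 1)) (t - k) := by
    rintro k t ⟨h1, h2⟩
    rcases h2.lt_or_eq with h | h
    · have : ⌊t⌋ = k := Int.floor_eq_iff.2 ⟨h1, h⟩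
      simp only [g, Int.fract, this]
    · have : ⌊t⌋ = k + 1 := Int.floor_eq_iff.2 ⟨by push_cast; linarith, by push_cast; linarith⟩
      simp only [g, Int.fract, this, h]
      simp
  have hcont : Continuous g := by
    refine locFin.continuous ?_ (fun k => isClosed_Icc) ?_
    · refine Set.eq_univ_of_forall fun t => Set.mem_iUnion.2 ⟨⌊t⌋, Int.floor_le t, ?_⟩
      exact (Int.lt_floor_add_one t).le
    · intro k
      refine ContinuousOn.congr 
        (f := fun t : ℝ => AffineMap.lineMap (x (k : ZMod n)) (x ((k : ZMod n) + 1)) (t - (k : ℝ))) ?_ (hIcc k)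
      simp only [AffineMap.lineMap_apply_module]
      fun_prop
  refine ⟨hper.lift, ?_, ?_, ?_⟩
  · exact continuous_coinduced_dom.2 hcont
  · have : Fact ((0 : ℝ) < n) := ⟨hn0⟩
    intro a b hab
    obtain ⟨s, hs, rfl⟩ := a.eq_coe_Ico
    obtain ⟨t, ht, rfl⟩ := b.eq_coe_Ico
    rw [hper.lift_coe, hper.lift_coe] at hab
    congr 1
    by_cases hij : (⌊s⌋ : ZMod n) = (⌊t⌋ : ZMod n)
    · have hfl : ⌊s⌋ = ⌊t⌋ := by
        rw [ZMod.intCast_eq_intCast_iff_dvd_sub] at hij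
        have h1 : 0 ≤ ⌊s⌋ := Int.floor_nonneg.2 hs.1
        have h2 : 0 ≤ ⌊t⌋ := Int.floor_nonneg.2 ht.1
        have h3 : ⌊s⌋ < n := Int.floor_lt.2 (by exact_mod_cast hs.2)
        have h4 : ⌊t⌋ < n := Int.floor_lt.2 (by exact_mod_cast ht.2)
        have := Int.eq_zero_of_abs_lt_dvd hij (by rw [abs_lt]; constructor <;> omega)
        omega
      simp only [g, hfl] at hab
      have hne : x (⌊t⌋ : ZMod n) ≠ x ((⌊t⌋ : ZMod n) + 1) := by
        intro h
        have h1 := hinj h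
        have : Fact (1 < n) := ⟨by omega⟩
        simp at h1
      have := AffineMap.lineMap_injective ℝ hne hab
      rw [← Int.floor_add_fract s, ← Int.floor_add_fract t, hfl, this]
    · exact absurd hab (hx _ _ hij _ _ (Int.fract_nonneg _) (Int.fract_lt_one _)
        (Int.fract_nonneg _) (Int.fract_lt_one _))
  · ext p
    constructor
    · intro hp
      obtain ⟨i, hi⟩ := Set.mem_iUnion.1 hp
      rw [segment_eq_image_lineMap] at hi
      obtain ⟨s, hs, rfl⟩ := hi
      refine ⟨(((i.val : ℤ) + s : ℝ) : AddCircle (n : ℝ)), ?_⟩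
      rw [hper.lift_coe, hIcc i.val _ ⟨by simpa using hs.1, by simpa using hs.2⟩]
      simp
    · rintro ⟨a, rfl⟩
      induction a using QuotientAddGroup.induction_on with
      | H t =>
        refine Set.mem_iUnion.2 ⟨(⌊t⌋ : ZMod n), ?_⟩
        rw [segment_eq_image_lineMap]
        exact ⟨Int.fract t, ⟨Int.fract_nonneg _, (Int.fract_lt_one _).le⟩, rfl⟩

lemma sum_zmod (n : ℕ) [NeZero n] (F : ZMod n → ℝ) :
    ∑ i : ZMod n, F i = ∑ k ∈ Finset.range n, F (k : ZMod n) := by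
  symm
  refine Finset.sum_bij (fun k _ => (k : ZMod n)) (by simp) ?_ ?_ (by simp)
  · intro a ha b hb hab
    have ha := Finset.mem_range.1 ha
    have hb := Finset.mem_range.1 hb
    have := congrArg ZMod.val hab
    rwa [ZMod.val_cast_of_lt ha, ZMod.val_cast_of_lt hb] at this
  · intro b _
    exact ⟨b.val, Finset.mem_range.2 (ZMod.val_lt b), by simp⟩

/-- The 2-opt move, normalised. -/
lemma two_opt_aux (n m r : ℕ) (hnm : n = m + 1 + r + 1) [NeZero n] (x : ZMod n → Pt)
    (hinj : Function.Injective x) :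
    ∃ y : ZMod n → Pt, Function.Injective y ∧ Set.range y = Set.range x ∧
      ∀ w : Pt → Pt → ℝ, (∀ p q, w p q = w q p) →
        ∑ k, w (y k) (y (k + 1)) + w (x (-1)) (x 0) + w (x m) (x (m + 1)) =
        ∑ k, w (x k) (x (k + 1)) + w (x (-1)) (x m) + w (x 0) (x (m + 1)) := by
  let e : ZMod n → ZMod n := fun k => if k.val ≤ m then (m : ZMod n) - k else k
  have hval : ∀ k : ZMod n, k.val ≤ m → ((m : ZMod n) - k).val = m - k.val := by
    intro k hk
    have : (m : ZMod n) - k = ((m - k.val : ℕ) : ZMod n) := by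
      rw [Nat.cast_sub hk]; simp
    rw [this, ZMod.val_cast_of_lt (by omega)]
  have he : Function.Involutive e := by
    intro k
    by_cases hk : k.val ≤ m
    · have h1 : e k = (m : ZMod n) - k := if_pos hk
      rw [h1]
      have h2 : ((m : ZMod n) - k).val ≤ m := by rw [hval k hk]; omega
      have : e ((m : ZMod n) - k) = (m : ZMod n) - ((m : ZMod n) - k) := if_pos h2
      rw [this]; ring
    · have h1 : e k = k := if_neg hk
      rw [h1, h1]
  have hY1 : ∀ k : ℕ, k ≤ m → e (k : ZMod n) = ((m - k : ℕ) : ZMod n) := by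
    intro k hk
    have : ((k : ZMod n)).val ≤ m := by rw [ZMod.val_cast_of_lt (by omega)]; exact hk
    have h : e (k : ZMod n) = (m : ZMod n) - k := if_pos this
    rw [h, Nat.cast_sub hk]
  have hY2 : ∀ k : ℕ, m < k → k < n → e (k : ZMod n) = (k : ZMod n) := by
    intro k hk hk2
    have : ¬ ((k : ZMod n)).val ≤ m := by rw [ZMod.val_cast_of_lt (by omega)]; omega
    exact if_neg this
  have hn0 : ((m + 1 + r + 1 : ℕ) : ZMod n) = 0 := by rw [← hnm]; simp
  have hm1 : (-1 : ZMod n) = ((m + 1 + r : ℕ) : ZMod n) := by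
    push_cast at hn0 ⊢
    linear_combination -hn0
  refine ⟨x ∘ e, hinj.comp he.injective, he.surjective.range_comp x, ?_⟩
  intro w hw
  rw [sum_zmod, sum_zmod]
  have hr : Finset.range n = Finset.range (m + 1 + r + 1) := by rw [hnm]
  rw [hr]
  rw [Finset.sum_range_succ, Finset.sum_range_add, Finset.sum_range_succ]
  rw [Finset.sum_range_succ _ (m + 1 + r), Finset.sum_range_add _ (m + 1) r,
    Finset.sum_range_succ _ m]
  have A : ∑ k ∈ Finset.range m, w ((x ∘ e) (k : ZMod n)) ((x ∘ e) ((k : ZMod n) + 1)) =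
      ∑ k ∈ Finset.range m, w (x (k : ZMod n)) (x ((k : ZMod n) + 1)) := by
    rw [← Finset.sum_range_reflect]
    refine Finset.sum_congr rfl fun k hk => ?_
    have hk := Finset.mem_range.1 hk
    have h1 := hY1 (m - 1 - k) (by omega)
    have h2 := hY1 (m - 1 - k + 1) (by omega)
    rw [show m - (m - 1 - k) = k + 1 by omega] at h1
    rw [show m - (m - 1 - k + 1) = k by omega] at h2
    push_cast at h1 h2
    simp only [Function.comp, h1, h2]
    rw [hw]
  have B : ∑ k ∈ Finset.range r, w ((x ∘ e) ((m + 1 + k : ℕ) : ZMod n))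
        ((x ∘ e) (((m + 1 + k : ℕ) : ZMod n) + 1)) =
      ∑ k ∈ Finset.range r, w (x ((m + 1 + k : ℕ) : ZMod n)) (x (((m + 1 + k : ℕ) : ZMod n) + 1)) := by
    refine Finset.sum_congr rfl fun k hk => ?_
    have hk := Finset.mem_range.1 hk
    have h1 := hY2 (m + 1 + k) (by omega) (by omega)
    have h2 := hY2 (m + 1 + k + 1) (by omega) (by omega)
    rw [Nat.cast_add_one] at h2
    simp only [Function.comp, h1, h2]
  rw [A, B]
  have c1 : e (m : ZMod n) = 0 := by simpa using hY1 m le_rfl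
  have c2 : e ((m : ZMod n) + 1) = (m : ZMod n) + 1 := by
    rcases Nat.eq_zero_or_pos r with h | h
    · have := hY2 (m + 1) (by omega) (by omega)
      simpa using this
    · have := hY2 (m + 1) (by omega) (by omega)
      simpa using this
  have c3 : e ((m + 1 + r : ℕ) : ZMod n) = ((m + 1 + r : ℕ) : ZMod n) :=
    hY2 _ (by omega) (by omega)
  have c4 : ((m + 1 + r : ℕ) : ZMod n) + 1 = 0 := by rw [← Nat.cast_add_one]; exact hn0
  have c5 : e 0 = (m : ZMod n) := by simpa using hY1 0 (by omega)
  simp only [Function.comp, c1, c2, c3, c4, c5, hm1]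
  ring

lemma two_opt (n : ℕ) [NeZero n] (x : ZMod n → Pt)
    (hinj : Function.Injective x) (i j : ZMod n) (hij : i ≠ j) :
    ∃ y : ZMod n → Pt, Function.Injective y ∧ Set.range y = Set.range x ∧
      ∀ w : Pt → Pt → ℝ, (∀ p q, w p q = w q p) →
        ∑ k, w (y k) (y (k + 1)) + w (x i) (x (i + 1)) + w (x j) (x (j + 1)) =
        ∑ k, w (x k) (x (k + 1)) + w (x i) (x j) + w (x (i + 1)) (x (j + 1)) := by
  set m := (j - (i + 1)).val with hm
  have hmn : m < n := ZMod.val_lt _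
  have hmc : (m : ZMod n) = j - (i + 1) := by simp [hm]
  have hm2 : m + 1 ≠ n := by
    intro h
    have : ((m + 1 : ℕ) : ZMod n) = 0 := by rw [h]; simp
    push_cast at this
    rw [hmc] at this
    apply hij
    linear_combination -this
  obtain ⟨y, hy1, hy2, hy3⟩ := two_opt_aux n m (n - m - 2) (by omega) (fun k => x (k + (i + 1)))
    (fun a b h => by simpa using hinj h)
  refine ⟨y, hy1, ?_, ?_⟩
  · rw [hy2]
    exact (Equiv.addRight (i + 1)).surjective.range_comp x
  · intro w hw
    have := hy3 w hw
    have hs : ∑ k, w (x (k + (i + 1))) (x (k + 1 + (i + 1))) = ∑ k, w (x k) (x (k + 1)) := by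
      rw [← Equiv.sum_comp (Equiv.addRight (i + 1)) (fun k => w (x k) (x (k + 1)))]
      refine Finset.sum_congr rfl fun k _ => ?_
      simp only [Equiv.coe_addRight]
      rw [show k + 1 + (i + 1) = k + (i + 1) + 1 by ring]
    rw [hs, hmc] at this
    rw [show -1 + (i + 1) = i by ring, show j - (i + 1) + (i + 1) = j by ring,
      show j - (i + 1) + 1 + (i + 1) = j + 1 by ring, zero_add] at this
    exact this

/-- Crossing weight of a pair of points with respect to a line. -/
noncomputable def cw (a b c : ℝ) (p q : Pt) : ℝ :=
  if (a * p.1 + b * p.2 - c) * (a * q.1 + b * q.2 - c) < 0 then 1 else 0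

lemma cw_symm (a b c : ℝ) (p q : Pt) : cw a b c p q = cw a b c q p := by
  simp only [cw, mul_comm]

/-- Every line avoiding the vertices crosses at most `d` edges. -/
def GoodEnum (n d : ℕ) [NeZero n] (x : ZMod n → Pt) : Prop :=
  ∀ a b c : ℝ, (∀ i, a * (x i).1 + b * (x i).2 - c ≠ 0) →
    ∑ i, cw a b c (x i) (x (i + 1)) ≤ d

lemma cw_uncross (a b c : ℝ) (A B C D : Pt) (s t : ℝ) (hs0 : 0 ≤ s) (hs1 : s ≤ 1) (ht0 : 0 ≤ t)
    (ht1 : t ≤ 1) (h1 : A.1 + s * (B.1 - A.1) = C.1 + t * (D.1 - C.1))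
    (h2 : A.2 + s * (B.2 - A.2) = C.2 + t * (D.2 - C.2))
    (hA : a * A.1 + b * A.2 - c ≠ 0) (hB : a * B.1 + b * B.2 - c ≠ 0)
    (hC : a * C.1 + b * C.2 - c ≠ 0) (hD : a * D.1 + b * D.2 - c ≠ 0) :
    cw a b c A C + cw a b c B D ≤ cw a b c A B + cw a b c C D := by
  unfold cw
  have key : (1 - s) * (a * A.1 + b * A.2 - c) + s * (a * B.1 + b * B.2 - c) =
      (1 - t) * (a * C.1 + b * C.2 - c) + t * (a * D.1 + b * D.2 - c) := by
    linear_combination a * h1 + b * h2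
  generalize a * A.1 + b * A.2 - c = gA at *
  generalize a * B.1 + b * B.2 - c = gB at *
  generalize a * C.1 + b * C.2 - c = gC at *
  generalize a * D.1 + b * D.2 - c = gD at *
  have pos : ∀ u v r : ℝ, 0 < u → 0 < v → 0 ≤ r → r ≤ 1 → 0 < (1 - r) * u + r * v := by
    intro u v r hu hv h0 h1
    rcases h0.eq_or_lt with h | h
    · subst h; simpa using hu
    · have := mul_pos h hv
      have := mul_nonneg (sub_nonneg.2 h1) hu.le
      linarith
  have neg : ∀ u v r : ℝ, u < 0 → v < 0 → 0 ≤ r → r ≤ 1 → (1 - r) * u + r * v < 0 := by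
    intro u v r hu hv h0 h1
    have := pos (-u) (-v) r (by linarith) (by linarith) h0 h1
    linarith
  rcases lt_or_gt_of_ne hA with hA | hA <;> rcases lt_or_gt_of_ne hB with hB | hB <;>
  rcases lt_or_gt_of_ne hC with hC | hC <;> rcases lt_or_gt_of_ne hD with hD | hD <;>
  first
  | (exfalso
     have k1 := neg _ _ s hA hB hs0 hs1
     have k2 := pos _ _ t hC hD ht0 ht1
     linarith)
  | (exfalso
     have k1 := pos _ _ s hA hB hs0 hs1
     have k2 := neg _ _ t hC hD ht0 ht1
     linarith)
  | (simp only [mul_neg_iff, hA, hB, hC, hD, hA.not_gt, hB.not_gt, hC.not_gt, hD.not_gt]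
     norm_num)

lemma collinear_of_det (p q r : Pt) (hpq : p ≠ q)
    (h : (q.1 - p.1) * (r.2 - p.2) - (q.2 - p.2) * (r.1 - p.1) = 0) :
    Collinear ℝ ({p, q, r} : Set Pt) := by
  rw [collinear_iff_of_mem (p₀ := p) (by simp)]
  refine ⟨q - p, ?_⟩
  have hne : (q.1 - p.1) ≠ 0 ∨ (q.2 - p.2) ≠ 0 := by
    by_contra hcon
    push Not at hcon
    exact hpq (Prod.ext (by linarith [hcon.1]) (by linarith [hcon.2]))
  intro z hz
  simp only [Set.mem_insert_iff, Set.mem_singleton_iff] at hz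
  rcases hz with rfl | rfl | rfl
  · exact ⟨0, by simp⟩
  · exact ⟨1, by simp⟩
  · rcases hne with h0 | h0
    · refine ⟨(z.1 - p.1) / (q.1 - p.1), Prod.ext ?_ ?_⟩
      · simp; field_simp; ring
      · simp; field_simp; linarith
    · refine ⟨(z.2 - p.2) / (q.2 - p.2), Prod.ext ?_ ?_⟩
      · simp; field_simp; linarith
      · simp; field_simp; ring

lemma GenPos.det_ne {X : Set Pt} (h : GenPos X) {p q r : Pt} (hp : p ∈ X) (hq : q ∈ X)
    (hr : r ∈ X) (hpq : p ≠ q) (hpr : p ≠ r) (hqr : q ≠ r) :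
    (q.1 - p.1) * (r.2 - p.2) - (q.2 - p.2) * (r.1 - p.1) ≠ 0 :=
  fun h0 => h p hp q hq r hr hpq hpr hqr (collinear_of_det p q r hpq h0)

/-- Euclidean distance. -/
noncomputable def ed (p q : Pt) : ℝ := dist (Complex.mk p.1 p.2) (Complex.mk q.1 q.2)

lemma ed_symm (p q : Pt) : ed p q = ed q p := dist_comm _ _

lemma ed_uncross (A B C D : Pt) (s t : ℝ) (hs0 : 0 ≤ s) (hs1 : s ≤ 1) (ht0 : 0 ≤ t)
    (ht1 : t ≤ 1) (h1 : A.1 + s * (B.1 - A.1) = C.1 + t * (D.1 - C.1))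
    (h2 : A.2 + s * (B.2 - A.2) = C.2 + t * (D.2 - C.2))
    (hABC : (B.1 - A.1) * (C.2 - A.2) - (B.2 - A.2) * (C.1 - A.1) ≠ 0)
    (hCDA : (D.1 - C.1) * (A.2 - C.2) - (D.2 - C.2) * (A.1 - C.1) ≠ 0) :
    ed A C + ed B D < ed A B + ed C D := by
  obtain ⟨a1, a2⟩ := A
  obtain ⟨b1, b2⟩ := B
  obtain ⟨c1, c2⟩ := C
  obtain ⟨d1, d2⟩ := D
  simp only at *
  unfold ed
  simp only
  set P : ℂ := ⟨a1 + s * (b1 - a1), a2 + s * (b2 - a2)⟩ with hP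
  have w1 : Wbtw ℝ (Complex.mk a1 a2) P ⟨b1, b2⟩ := by
    refine ⟨s, ⟨hs0, hs1⟩, ?_⟩
    apply Complex.ext <;> simp [AffineMap.lineMap_apply, hP] <;> ring
  have w2 : Wbtw ℝ (Complex.mk c1 c2) P ⟨d1, d2⟩ := by
    refine ⟨t, ⟨ht0, ht1⟩, ?_⟩
    apply Complex.ext <;> simp [AffineMap.lineMap_apply, hP] <;> linarith
  have e1 := w1.dist_add_dist
  have e2 := w2.dist_add_dist
  have t1 := dist_triangle (Complex.mk b1 b2) P ⟨d1, d2⟩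
  have t2 := dist_triangle (Complex.mk a1 a2) P ⟨c1, c2⟩
  have t3 : dist (Complex.mk a1 a2) ⟨c1, c2⟩ ≠ dist (Complex.mk a1 a2) P + dist P ⟨c1, c2⟩ := by
    intro h
    have w3 := dist_add_dist_eq_iff.1 h.symm
    obtain ⟨u, -, hu⟩ := w3
    have u1 := congrArg Complex.re hu
    have u2 := congrArg Complex.im hu
    simp [AffineMap.lineMap_apply, hP] at u1 u2
    have hs : s * ((b1 - a1) * (c2 - a2) - (b2 - a2) * (c1 - a1)) = 0 := by
      linear_combination (c1 - a1) * u2 - (c2 - a2) * u1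
    have hs := (mul_eq_zero.1 hs).resolve_right hABC
    subst hs
    apply hCDA
    linear_combination (d1 - c1) * h2 - (d2 - c2) * h1
  have t4 := lt_of_le_of_ne t2 t3
  rw [dist_comm P (Complex.mk c1 c2)] at t4
  rw [dist_comm (Complex.mk b1 b2) P] at t1
  linarith

lemma exists_simple (n d : ℕ) [NeZero n] (hn : 3 ≤ n) (X : Finset Pt) (hgp : GenPos ↑X)
    (x₀ : ZMod n → Pt) (hinj₀ : Function.Injective x₀) (hr₀ : (↑X : Set Pt) = Set.range x₀)
    (hg₀ : GoodEnum n d x₀) :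
    ∃ x : ZMod n → Pt, Function.Injective x ∧ (↑X : Set Pt) = Set.range x ∧
      GoodEnum n d x ∧ ∀ i j : ZMod n, i ≠ j → ∀ s t : ℝ, 0 ≤ s → s < 1 → 0 ≤ t → t < 1 →
      AffineMap.lineMap (x i) (x (i + 1)) s ≠ AffineMap.lineMap (x j) (x (j + 1)) t := by
  let S : Set (ZMod n → Pt) :=
    {x | Function.Injective x ∧ (↑X : Set Pt) = Set.range x ∧ GoodEnum n d x}
  have hfin : S.Finite := by
    refine (Set.Finite.pi (t := fun _ : ZMod n => (↑X : Set Pt))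
      (fun _ => X.finite_toSet)).subset ?_
    rintro x ⟨-, h, -⟩ i -
    rw [h]
    exact ⟨i, rfl⟩
  obtain ⟨x, ⟨hinj, hr, hg⟩, hmin⟩ := Set.exists_min_image S
    (fun x => ∑ k, ed (x k) (x (k + 1))) hfin ⟨x₀, hinj₀, hr₀, hg₀⟩
  refine ⟨x, hinj, hr, hg, ?_⟩
  intro i j hij s t hs0 hs1 ht0 ht1 heq
  have hmem : ∀ k, x k ∈ (↑X : Set Pt) := fun k => by rw [hr]; exact ⟨k, rfl⟩
  have h1 := congrArg Prod.fst heq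
  have h2 := congrArg Prod.snd heq
  have : Fact (1 < n) := ⟨by omega⟩
  have one_ne : (1 : ZMod n) ≠ 0 := one_ne_zero
  have two_ne : (2 : ZMod n) ≠ 0 := by
    intro h
    have : ((2 : ℕ) : ZMod n) = 0 := by exact_mod_cast h
    rw [ZMod.natCast_eq_zero_iff] at this
    have := Nat.le_of_dvd (by norm_num) this
    omega
  have n1 : ∀ k : ZMod n, x k ≠ x (k + 1) := fun k h => one_ne (by
    have := hinj h; linear_combination -this)
  have n2 : ∀ k : ZMod n, x k ≠ x (k + 1 + 1) := fun k h => two_ne (by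
    have := hinj h; linear_combination -this)
  simp only [AffineMap.lineMap_apply, vsub_eq_sub, vadd_eq_add, Prod.fst_add, Prod.snd_add,
    Prod.smul_fst, Prod.smul_snd, Prod.fst_sub, Prod.snd_sub, smul_eq_mul] at h1 h2
  by_cases hj : j = i + 1
  · subst hj
    have hd := hgp.det_ne (hmem i) (hmem (i + 1)) (hmem (i + 1 + 1)) (n1 _) (n2 _) (n1 _)
    generalize x i = A at *
    generalize x (i + 1) = B at *
    generalize x (i + 1 + 1) = D at *
    have : (1 - s) * ((B.1 - A.1) * (D.2 - A.2) - (B.2 - A.2) * (D.1 - A.1)) = 0 := by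
      linear_combination (D.1 - B.1) * h2 - (D.2 - B.2) * h1
    rcases mul_eq_zero.1 this with h | h
    · linarith
    · exact hd h
  by_cases hi : i = j + 1
  · subst hi
    have hd := hgp.det_ne (hmem j) (hmem (j + 1)) (hmem (j + 1 + 1)) (n1 _) (n2 _) (n1 _)
    generalize x j = A at *
    generalize x (j + 1) = B at *
    generalize x (j + 1 + 1) = D at *
    have : (1 - t) * ((B.1 - A.1) * (D.2 - A.2) - (B.2 - A.2) * (D.1 - A.1)) = 0 := by
      linear_combination -(D.1 - B.1) * h2 + (D.2 - B.2) * h1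
    rcases mul_eq_zero.1 this with h | h
    · linarith
    · exact hd h
  have nAC : x i ≠ x j := hinj.ne hij
  have nBC : x (i + 1) ≠ x j := hinj.ne (Ne.symm hj)
  have nDA : x (j + 1) ≠ x i := hinj.ne (Ne.symm hi)
  have d1 := hgp.det_ne (hmem i) (hmem (i + 1)) (hmem j) (n1 _) nAC nBC
  have d2 := hgp.det_ne (hmem j) (hmem (j + 1)) (hmem i) (n1 _) nAC.symm nDA
  have h1' : (x i).1 + s * ((x (i + 1)).1 - (x i).1) = (x j).1 + t * ((x (j + 1)).1 - (x j).1) := by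
    linarith
  have h2' : (x i).2 + s * ((x (i + 1)).2 - (x i).2) = (x j).2 + t * ((x (j + 1)).2 - (x j).2) := by
    linarith
  have hlen := ed_uncross _ _ _ _ s t hs0 hs1.le ht0 ht1.le h1' h2' d1 d2
  obtain ⟨y, hy1, hy2, hy3⟩ := two_opt n x hinj i j hij
  have hyS : y ∈ S := by
    refine ⟨hy1, by rw [hy2, hr], ?_⟩
    intro a b c hy
    have hx : ∀ i, a * (x i).1 + b * (x i).2 - c ≠ 0 := by
      intro k
      have : x k ∈ Set.range y := by rw [hy2]; exact ⟨k, rfl⟩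
      obtain ⟨l, hl⟩ := this
      rw [← hl]
      exact hy l
    have e1 := hy3 (cw a b c) (cw_symm a b c)
    have e2 := cw_uncross a b c _ _ _ _ s t hs0 hs1.le ht0 ht1.le h1' h2' (hx _) (hx _) (hx _) (hx _)
    have e3 := hg a b c hx
    linarith
  have := hmin y hyS
  have e1 := hy3 ed ed_symm
  linarith

lemma interp (Z : Finset Pt) (hZ : Z.card ≤ 2) (ε : Pt → ℝ) :
    ∃ a b c : ℝ, ∀ z ∈ Z, a * z.1 + b * z.2 - c = ε z := by
  have h : Z.card = 0 ∨ Z.card = 1 ∨ Z.card = 2 := by omega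
  rcases h with h | h | h
  · rw [Finset.card_eq_zero] at h
    subst h
    exact ⟨0, 0, 0, by simp⟩
  · obtain ⟨z, rfl⟩ := Finset.card_eq_one.1 h
    exact ⟨0, 0, -ε z, by simp⟩
  · obtain ⟨z, w, hzw, rfl⟩ := Finset.card_eq_two.1 h
    have hN : (w.1 - z.1) ^ 2 + (w.2 - z.2) ^ 2 ≠ 0 := by
      intro h0
      apply hzw
      have e1 : w.1 - z.1 = 0 := by nlinarith [sq_nonneg (w.1 - z.1), sq_nonneg (w.2 - z.2)]
      have e2 : w.2 - z.2 = 0 := by nlinarith [sq_nonneg (w.1 - z.1), sq_nonneg (w.2 - z.2)]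
      exact Prod.ext (by linarith) (by linarith)
    set N := (w.1 - z.1) ^ 2 + (w.2 - z.2) ^ 2 with hNd
    set k := (ε w - ε z) / N with hk
    have hkN : k * N = ε w - ε z := by rw [hk]; field_simp
    refine ⟨k * (w.1 - z.1), k * (w.2 - z.2),
      k * (w.1 - z.1) * z.1 + k * (w.2 - z.2) * z.2 - ε z, ?_⟩
    intro p hp
    simp only [Finset.mem_insert, Finset.mem_singleton] at hp
    rcases hp with rfl | rfl
    · ring
    · rw [hNd] at hkN
      linear_combination hkN

lemma stab_of_good (n d : ℕ) [NeZero n] (hn : 3 ≤ n) (X : Finset Pt) (hgp : GenPos ↑X)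
    (x : ZMod n → Pt) (hinj : Function.Injective x) (hr : (↑X : Set Pt) = Set.range x)
    (hg : GoodEnum n d x) :
    StabLE (⋃ i : ZMod n, segment ℝ (x i) (x (i + 1))) d := by
  classical
  rintro l ⟨a, b, c, hab, rfl⟩
  have hmem : ∀ k, x k ∈ X := fun k => by
    have : x k ∈ (↑X : Set Pt) := by rw [hr]; exact ⟨k, rfl⟩
    exact this
  set P := ⋃ i : ZMod n, segment ℝ (x i) (x (i + 1)) with hP
  set ℓ : Set Pt := {p : Pt | a * p.1 + b * p.2 = c} with hℓ
  let Z := X.filter (fun p => a * p.1 + b * p.2 - c = 0)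
  have hthree : ∀ p ∈ X, ∀ q ∈ X, ∀ r ∈ X, p ≠ q → p ≠ r → q ≠ r → a * p.1 + b * p.2 - c = 0 →
      a * q.1 + b * q.2 - c = 0 → a * r.1 + b * r.2 - c = 0 → False := by
    intro p hp q hq r hrX h1 h2 h3 e1 e2 e3
    have hd := hgp.det_ne hp hq hrX h1 h2 h3
    rcases hab with h | h
    · have : a * ((q.1 - p.1) * (r.2 - p.2) - (q.2 - p.2) * (r.1 - p.1)) = 0 := by
        linear_combination (r.2 - p.2) * (e2 - e1) - (q.2 - p.2) * (e3 - e1)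
      exact hd ((mul_eq_zero.1 this).resolve_left h)
    · have : b * ((q.1 - p.1) * (r.2 - p.2) - (q.2 - p.2) * (r.1 - p.1)) = 0 := by
        linear_combination (q.1 - p.1) * (e3 - e1) - (r.1 - p.1) * (e2 - e1)
      exact hd ((mul_eq_zero.1 this).resolve_left h)
  have hZ : Z.card ≤ 2 := by
    by_contra hcon
    push Not at hcon
    obtain ⟨p, hp, q, hq, r, hrX, h1, h2, h3⟩ := Finset.two_lt_card.1 hcon
    simp only [Z, Finset.mem_filter] at hp hq hrX
    exact hthree p hp.1 q hq.1 r hrX.1 h1 h2 h3 hp.2 hq.2 hrX.2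
  -- the signs to give to the vertices on the line
  let ε' : ZMod n → ℝ := fun k =>
    if a * (x (k - 1)).1 + b * (x (k - 1)).2 - c = 0 then 1
    else -(a * (x (k - 1)).1 + b * (x (k - 1)).2 - c)
  let ε : Pt → ℝ := fun p => ε' (Function.invFun x p)
  have hε : ∀ k, ε (x k) = ε' k := fun k => by
    simp only [ε]; rw [Function.leftInverse_invFun hinj k]
  have hε0 : ∀ k, ε' k ≠ 0 := by
    intro k
    simp only [ε']
    split_ifs with h
    · exact one_ne_zero
    · exact neg_ne_zero.2 h
  obtain ⟨a', b', c', hh⟩ := interp Z hZ ε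
  have hδ : ∃ δ : ℝ, 0 < δ ∧ ∀ p ∈ X, a * p.1 + b * p.2 - c ≠ 0 →
      0 < (a * p.1 + b * p.2 - c) * ((a * p.1 + b * p.2 - c) + δ * (a' * p.1 + b' * p.2 - c')) := by
    have : ∀ᶠ δ : ℝ in nhdsWithin 0 (Set.Ioi 0), ∀ p ∈ X, a * p.1 + b * p.2 - c ≠ 0 →
      0 < (a * p.1 + b * p.2 - c) * ((a * p.1 + b * p.2 - c) + δ * (a' * p.1 + b' * p.2 - c')) := by
      rw [Filter.eventually_all_finset]
      intro p _
      by_cases h0 : a * p.1 + b * p.2 - c = 0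
      · exact Filter.Eventually.of_forall fun δ h => absurd h0 h
      · have hc : Continuous fun δ : ℝ => (a * p.1 + b * p.2 - c) *
          ((a * p.1 + b * p.2 - c) + δ * (a' * p.1 + b' * p.2 - c')) := by fun_prop
        have := hc.continuousAt (x := 0)
        have h2 := this.eventually_const_lt (u := 0) (by
          simp only [zero_mul, add_zero]
          exact mul_self_pos.2 h0)
        filter_upwards [nhdsWithin_le_nhds h2] with δ hδ _ using hδ
    obtain ⟨δ, h1, h2⟩ := (this.and self_mem_nhdsWithin).exists
    exact ⟨δ, h2, h1⟩
  obtain ⟨δ, hδ0, hδ⟩ := hδ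
  set A := a + δ * a' with hA
  set B := b + δ * b' with hB
  set C := c + δ * c' with hC
  have hG : ∀ p : Pt, A * p.1 + B * p.2 - C =
      (a * p.1 + b * p.2 - c) + δ * (a' * p.1 + b' * p.2 - c') := by
    intro p; rw [hA, hB, hC]; ring
  have hG1 : ∀ k, a * (x k).1 + b * (x k).2 - c ≠ 0 →
      0 < (a * (x k).1 + b * (x k).2 - c) * (A * (x k).1 + B * (x k).2 - C) := by
    intro k hk
    rw [hG]
    exact hδ _ (hmem k) hk
  have hG2 : ∀ k, a * (x k).1 + b * (x k).2 - c = 0 →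
      A * (x k).1 + B * (x k).2 - C = δ * ε' k := by
    intro k hk
    rw [hG, hk, hh (x k) (Finset.mem_filter.2 ⟨hmem k, hk⟩), hε, zero_add]
  have hG3 : ∀ k, A * (x k).1 + B * (x k).2 - C ≠ 0 := by
    intro k
    by_cases hk : a * (x k).1 + b * (x k).2 - c = 0
    · rw [hG2 k hk]
      exact mul_ne_zero hδ0.ne' (hε0 k)
    · intro h
      have := hG1 k hk
      rw [h] at this
      simp at this
  have hcount := hg A B C hG3
  -- a vertex on the line whose predecessor is not: the edge into it is crossing
  have hpred : ∀ k, a * (x (k + 1)).1 + b * (x (k + 1)).2 - c = 0 →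
      a * (x k).1 + b * (x k).2 - c ≠ 0 →
      (A * (x k).1 + B * (x k).2 - C) * (A * (x (k + 1)).1 + B * (x (k + 1)).2 - C) < 0 := by
    intro k h1 h2
    rw [hG2 (k + 1) h1]
    have h3 : ε' (k + 1) = -(a * (x k).1 + b * (x k).2 - c) := by
      simp only [ε', add_sub_cancel_right]
      rw [if_neg h2]
    rw [h3]
    have := mul_pos hδ0 (hG1 k h2)
    linarith
  have hconv : ∀ k, IsPreconnected (segment ℝ (x k) (x (k + 1)) ∩ ℓ) := by
    intro k
    refine ((convex_segment _ _).inter ?_).isPreconnected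
    intro p hp q hq u v _ _ huv
    simp only [hℓ, Set.mem_ofPred_eq, Prod.fst_add, Prod.snd_add, Prod.smul_fst, Prod.smul_snd,
      smul_eq_mul] at hp hq ⊢
    linear_combination u * hp + v * hq + c * huv
  have hsubP : ∀ k, segment ℝ (x k) (x (k + 1)) ∩ ℓ ⊆ P ∩ ℓ := fun k =>
    Set.inter_subset_inter_left _ (Set.subset_iUnion (fun i => segment ℝ (x i) (x (i + 1))) k)
  have hcomp : ∀ k, ∀ p ∈ segment ℝ (x k) (x (k + 1)) ∩ ℓ,
      ∀ q ∈ segment ℝ (x k) (x (k + 1)) ∩ ℓ,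
      connectedComponentIn (P ∩ ℓ) p = connectedComponentIn (P ∩ ℓ) q := by
    intro k p hp q hq
    exact connectedComponentIn_eq ((hconv k).subset_connectedComponentIn hp (hsubP k) hq)
  have one_ne : (1 : ZMod n) ≠ 0 := by
    have : Fact (1 < n) := ⟨by omega⟩
    exact one_ne_zero
  have two_ne : (2 : ZMod n) ≠ 0 := by
    intro h
    have : ((2 : ℕ) : ZMod n) = 0 := by exact_mod_cast h
    rw [ZMod.natCast_eq_zero_iff] at this
    have := Nat.le_of_dvd (by norm_num) this
    omega
  -- each vertex on the line
  have hvert : ∀ k, a * (x k).1 + b * (x k).2 - c = 0 → ∃ e : ZMod n,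
      (A * (x e).1 + B * (x e).2 - C) * (A * (x (e + 1)).1 + B * (x (e + 1)).2 - C) < 0 ∧
      ∃ q ∈ segment ℝ (x e) (x (e + 1)) ∩ ℓ,
        connectedComponentIn (P ∩ ℓ) (x k) = connectedComponentIn (P ∩ ℓ) q := by
    intro k hk
    by_cases h1 : a * (x (k - 1)).1 + b * (x (k - 1)).2 - c = 0
    · have h2 : a * (x (k - 2)).1 + b * (x (k - 2)).2 - c ≠ 0 := by
        intro h2
        refine hthree _ (hmem k) _ (hmem (k - 1)) _ (hmem (k - 2)) ?_ ?_ ?_ hk h1 h2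
        · exact hinj.ne fun h => one_ne (by linear_combination h)
        · exact hinj.ne fun h => two_ne (by linear_combination h)
        · exact hinj.ne fun h => one_ne (by linear_combination h)
      have e1 : k - 2 + 1 = k - 1 := by ring
      refine ⟨k - 2, hpred _ (by rw [e1]; exact h1) h2, x (k - 1),
        ⟨by rw [e1]; exact right_mem_segment _ _ _, by simp only [hℓ, Set.mem_ofPred_eq]; linarith⟩, ?_⟩
      refine hcomp (k - 1) _ ⟨?_, ?_⟩ _ ⟨left_mem_segment _ _ _, ?_⟩
      · rw [sub_add_cancel]; exact right_mem_segment _ _ _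
      · simp only [hℓ, Set.mem_ofPred_eq]; linarith
      · simp only [hℓ, Set.mem_ofPred_eq]; linarith
    · refine ⟨k - 1, hpred _ (by rw [sub_add_cancel]; exact hk) h1, x k,
        ⟨by rw [sub_add_cancel]; exact right_mem_segment _ _ _,
          by simp only [hℓ, Set.mem_ofPred_eq]; linarith⟩, rfl⟩
  have hpt : ∀ p ∈ P ∩ ℓ, ∃ e : ZMod n,
      (A * (x e).1 + B * (x e).2 - C) * (A * (x (e + 1)).1 + B * (x (e + 1)).2 - C) < 0 ∧
      ∃ q ∈ segment ℝ (x e) (x (e + 1)) ∩ ℓ,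
        connectedComponentIn (P ∩ ℓ) p = connectedComponentIn (P ∩ ℓ) q := by
    rintro p ⟨hp, hpl⟩
    obtain ⟨k, hk⟩ := Set.mem_iUnion.1 hp
    by_cases h1 : a * (x k).1 + b * (x k).2 - c = 0
    · obtain ⟨e, he, q, hq, hq2⟩ := hvert k h1
      refine ⟨e, he, q, hq, ?_⟩
      rw [← hq2]
      exact hcomp k _ ⟨hk, hpl⟩ _ ⟨left_mem_segment _ _ _, by
        simp only [hℓ, Set.mem_ofPred_eq]; linarith⟩
    by_cases h2 : a * (x (k + 1)).1 + b * (x (k + 1)).2 - c = 0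
    · obtain ⟨e, he, q, hq, hq2⟩ := hvert (k + 1) h2
      refine ⟨e, he, q, hq, ?_⟩
      rw [← hq2]
      exact hcomp k _ ⟨hk, hpl⟩ _ ⟨right_mem_segment _ _ _, by
        simp only [hℓ, Set.mem_ofPred_eq]; linarith⟩
    refine ⟨k, ?_, p, ⟨hk, hpl⟩, rfl⟩
    obtain ⟨u, v, hu, hv, huv, rfl⟩ := hk
    simp only [hℓ, Set.mem_ofPred_eq, Prod.fst_add, Prod.snd_add, Prod.smul_fst, Prod.smul_snd,
      smul_eq_mul] at hpl
    have hz : u * (a * (x k).1 + b * (x k).2 - c) +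
        v * (a * (x (k + 1)).1 + b * (x (k + 1)).2 - c) = 0 := by
      linear_combination hpl - c * huv
    have g1 := hG1 k h1
    have g2 := hG1 (k + 1) h2
    generalize a * (x k).1 + b * (x k).2 - c = g at *
    generalize a * (x (k + 1)).1 + b * (x (k + 1)).2 - c = g' at *
    generalize A * (x k).1 + B * (x k).2 - C = f at *
    generalize A * (x (k + 1)).1 + B * (x (k + 1)).2 - C = f' at *
    have hgg : g * g' < 0 := by
      rcases lt_or_gt_of_ne h1 with k1 | k1 <;> rcases lt_or_gt_of_ne h2 with k2 | k2
      · exfalso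
        rcases hu.eq_or_lt with h | h
        · have : v = 1 := by linarith
          subst h; subst this; linarith
        · have := mul_pos h (neg_pos.2 k1)
          have := mul_nonneg hv (neg_pos.2 k2).le
          linarith
      · exact mul_neg_of_neg_of_pos k1 k2
      · exact mul_neg_of_pos_of_neg k1 k2
      · exfalso
        rcases hu.eq_or_lt with h | h
        · have : v = 1 := by linarith
          subst h; subst this; linarith
        · have := mul_pos h k1
          have := mul_nonneg hv k2.le
          linarith
    have h3 : 0 < (g * g') * (f * f') := by
      have := mul_pos g1 g2
      linarith
    exact neg_of_mul_pos_right h3 hgg.le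
  intro f hf
  choose e he q hq hq2 using fun i => hpt (f i) (hf i)
  by_contra hcon
  push Not at hcon
  have hei : Function.Injective e := by
    intro i j hij
    by_contra hne
    apply hcon i j hne
    rw [hq2 i, hq2 j]
    refine hcomp (e i) _ (hq i) _ ?_
    rw [hij]
    exact hq j
  have hcard : ((d + 1 : ℕ) : ℝ) ≤ ∑ i, cw A B C (x i) (x (i + 1)) := by
    have h1 : ∑ i ∈ Finset.univ.image e, cw A B C (x i) (x (i + 1)) = ((d + 1 : ℕ) : ℝ) := by
      rw [Finset.sum_image (fun i _ j _ h => hei h)]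
      have : ∀ i, cw A B C (x (e i)) (x (e i + 1)) = 1 := fun i => if_pos (he i)
      simp [this]
    rw [← h1]
    refine Finset.sum_le_sum_of_subset_of_nonneg (Finset.subset_univ _) ?_
    intro i _ _
    unfold cw
    split_ifs <;> norm_num
  push_cast at hcard
  linarith

lemma exists_zero_of_mul_neg (h : ℝ → ℝ) (hh : Continuous h) (u v : ℝ) (huv : u ≤ v)
    (hneg : h u * h v < 0) : ∃ s ∈ Set.Icc u v, h s = 0 := by
  rcases mul_neg_iff.1 hneg with ⟨h1, h2⟩ | ⟨h1, h2⟩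
  · exact intermediate_value_Icc' huv hh.continuousOn ⟨h2.le, h1.le⟩
  · exact intermediate_value_Icc huv hh.continuousOn ⟨h1.le, h2.le⟩

lemma exists_good (X : Finset Pt) (n : ℕ) [NeZero n] (hn : X.card = n) (d : ℕ)
    (J : Set Pt) (hJ : IsJordanCurve J) (hstab : StabLE J d) (hXJ : (↑X : Set Pt) ⊆ J) :
    ∃ x : ZMod n → Pt, Function.Injective x ∧ (↑X : Set Pt) = Set.range x ∧ GoodEnum n d x := by
  classical
  obtain ⟨G, hGc, hGi, rfl⟩ := (jordan_iff 1 one_pos J).1 hJ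
  have hnpos : 0 < n := Nat.pos_of_ne_zero (NeZero.ne n)
  have : Fact ((0 : ℝ) < 1) := ⟨one_pos⟩
  let γ : ℝ → Pt := fun t => G (t : AddCircle (1 : ℝ))
  have hγ : Continuous γ := hGc.comp (AddCircle.continuous_mk' 1)
  have hγi : ∀ α u v : ℝ, u ∈ Set.Ico α (α + 1) → v ∈ Set.Ico α (α + 1) → γ u = γ v → u = v :=
    fun α u v hu hv h => (AddCircle.coe_eq_coe_iff_of_mem_Ico hu hv).1 (hGi h)
  have hγp : ∀ t, γ (t + 1) = γ t := fun t => by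
    simp only [γ]; rw [AddCircle.coe_add_period]
  have hγs : ∀ α : ℝ, ∀ p ∈ Set.range G, ∃ t ∈ Set.Ico α (α + 1), γ t = p := by
    rintro α p ⟨θ, rfl⟩
    have : θ ∈ ((↑) : ℝ → AddCircle (1 : ℝ)) '' Set.Ico α (α + 1) := by
      rw [AddCircle.coe_image_Ico_eq]; trivial
    obtain ⟨t, ht, rfl⟩ := this
    exact ⟨t, ht, rfl⟩
  have hex : ∀ p : Pt, ∃ t : ℝ, p ∈ X → t ∈ Set.Ico (0 : ℝ) 1 ∧ γ t = p := by
    intro p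
    by_cases hp : p ∈ X
    · obtain ⟨t, ht, h⟩ := hγs 0 p (hXJ hp)
      rw [zero_add] at ht
      exact ⟨t, fun _ => ⟨ht, h⟩⟩
    · exact ⟨0, fun h => absurd h hp⟩
  choose t ht using hex
  have hS : (X.image t).card = n := by
    rw [Finset.card_image_of_injOn, hn]
    intro p hp q hq hpq
    rw [← (ht p hp).2, ← (ht q hq).2, hpq]
  let o := (X.image t).orderEmbOfFin hS
  have ho : ∀ k, ∃ p ∈ X, o k = t p := by
    intro k
    have := (X.image t).orderEmbOfFin_mem hS k
    obtain ⟨p, hp, h⟩ := Finset.mem_image.1 this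
    exact ⟨p, hp, h.symm⟩
  have ho1 : ∀ k, o k ∈ Set.Ico (0 : ℝ) 1 := by
    intro k
    obtain ⟨p, hp, h⟩ := ho k
    rw [h]; exact (ht p hp).1
  have ho2 : ∀ k, γ (o k) ∈ X := by
    intro k
    obtain ⟨p, hp, h⟩ := ho k
    rw [h, (ht p hp).2]; exact hp
  let τ : ℕ → ℝ := fun k => if h : k < n then o ⟨k, h⟩ else o ⟨0, hnpos⟩ + 1
  have hτ : ∀ k (h : k < n), τ k = o ⟨k, h⟩ := fun k h => dif_pos h
  have hτn : τ n = τ 0 + 1 := by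
    rw [hτ 0 hnpos]; exact dif_neg (lt_irrefl n)
  have hτX : ∀ k, k ≤ n → γ (τ k) ∈ X := by
    intro k hk
    rcases hk.lt_or_eq with h | h
    · rw [hτ k h]; exact ho2 _
    · rw [h, hτn, hγp, hτ 0 hnpos]; exact ho2 _
  have hτ1 : ∀ k, k < n → τ k ∈ Set.Ico (0 : ℝ) 1 := fun k hk => by rw [hτ k hk]; exact ho1 _
  have hτm : ∀ k l, k ≤ l → l ≤ n → τ k ≤ τ l := by
    intro k l hkl hl
    rcases hl.lt_or_eq with h | h
    · rw [hτ k (by omega), hτ l h]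
      exact o.monotone hkl
    · subst h
      rcases hkl.lt_or_eq with h | h
      · rw [hτn]
        have := (hτ1 k h).2
        have := (hτ1 0 hnpos).1
        linarith
      · rw [h]
  let x : ZMod n → Pt := fun i => γ (τ i.val)
  have hxs : ∀ i : ZMod n, x (i + 1) = γ (τ (i.val + 1)) := by
    intro i
    have hi := ZMod.val_lt i
    by_cases h : i.val + 1 < n
    · simp only [x]
      have : i + 1 = ((i.val + 1 : ℕ) : ZMod n) := by simp
      rw [this, ZMod.val_cast_of_lt h]
    · have h : i.val + 1 = n := by omega
      have : i + 1 = ((i.val + 1 : ℕ) : ZMod n) := by simp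
      simp only [x]
      rw [this, h, hτn, hγp]
      simp
  have hxinj : Function.Injective x := by
    intro i j hij
    have h1 := hτ1 i.val (ZMod.val_lt i)
    have h2 := hτ1 j.val (ZMod.val_lt j)
    have := hγi 0 _ _ (by simpa using h1) (by simpa using h2) hij
    rw [hτ _ (ZMod.val_lt i), hτ _ (ZMod.val_lt j)] at this
    have := o.injective this
    exact ZMod.val_injective n (by simpa using this)
  refine ⟨x, hxinj, ?_, ?_⟩
  · have hsub : Finset.univ.image x ⊆ X := by
      intro p hp
      obtain ⟨i, -, rfl⟩ := Finset.mem_image.1 hp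
      exact hτX _ (ZMod.val_lt i).le
    have := Finset.eq_of_subset_of_card_le hsub (by
      rw [Finset.card_image_of_injective _ hxinj, Finset.card_univ, ZMod.card, hn])
    rw [← this]
    simp
  · intro a b c hne
    by_contra hcon
    push Not at hcon
    let h : Pt → ℝ := fun p => a * p.1 + b * p.2 - c
    have hhc : Continuous fun t => h (γ t) := by
      simp only [h]
      fun_prop
    have hneX : ∀ k, k ≤ n → h (γ (τ k)) ≠ 0 := by
      intro k hk
      rcases hk.lt_or_eq with h' | h'
      · have := hne (k : ZMod n)
        simp only [x, ZMod.val_cast_of_lt h'] at this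
        exact this
      · rw [h', hτn, hγp]
        have := hne 0
        simpa [x] using this
    let F : Finset (ZMod n) := Finset.univ.filter fun i => h (x i) * h (x (i + 1)) < 0
    have hF : ∑ i, cw a b c (x i) (x (i + 1)) = F.card := by
      simp only [cw, F, h]
      rw [Finset.sum_boole]
    rw [hF] at hcon
    have hF1 : d + 1 ≤ F.card := by exact_mod_cast hcon
    have hab : a ≠ 0 ∨ b ≠ 0 := by
      by_contra hab
      push Not at hab
      obtain ⟨i, hi⟩ := Finset.card_pos.1 (by omega : 0 < F.card)
      have := (Finset.mem_filter.1 hi).2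
      simp only [h, hab.1, hab.2] at this
      nlinarith [sq_nonneg c]
    obtain ⟨F', hF', hF'c⟩ := Finset.exists_subset_card_eq hF1
    let e := (F'.equivFinOfCardEq hF'c).symm
    have hz : ∀ k : Fin (d + 1), ∃ s ∈ Set.Icc (τ (e k : ZMod n).val) (τ ((e k : ZMod n).val + 1)),
        h (γ s) = 0 := by
      intro k
      have := (Finset.mem_filter.1 (hF' (e k).2)).2
      rw [hxs] at this
      have hlt := ZMod.val_lt (e k : ZMod n)
      exact exists_zero_of_mul_neg (fun t => h (γ t)) hhc _ _ (hτm _ _ (by omega) (by omega)) this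
    choose s hs hs0 using hz
    set ℓ : Set Pt := {p : Pt | a * p.1 + b * p.2 = c} with hℓ
    obtain ⟨k, l, hkl, heq⟩ := hstab ℓ ⟨a, b, c, hab, rfl⟩ (fun k => γ (s k)) (fun k =>
      ⟨⟨_, rfl⟩, by
        have := hs0 k
        simp only [h] at this
        simp only [hℓ, Set.mem_ofPred_eq]
        linarith⟩)
    -- without loss of generality the first index is smaller
    have main : ∀ k l : Fin (d + 1), (e k : ZMod n).val < (e l : ZMod n).val →
        connectedComponentIn (Set.range G ∩ ℓ) (γ (s k)) =
          connectedComponentIn (Set.range G ∩ ℓ) (γ (s l)) → False := by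
      intro k l hlt heq
      set i := (e k : ZMod n).val with hi
      set j := (e l : ZMod n).val with hj
      have hjn : j < n := ZMod.val_lt _
      have hmemℓ : ∀ k, γ (s k) ∈ Set.range G ∩ ℓ := fun k =>
        ⟨⟨_, rfl⟩, by
          have := hs0 k
          simp only [h] at this
          simp only [hℓ, Set.mem_ofPred_eq]
          linarith⟩
      have hpc := isPreconnected_connectedComponentIn (x := γ (s k)) (F := Set.range G ∩ ℓ)
      have hsub := connectedComponentIn_subset (Set.range G ∩ ℓ) (γ (s k))
      have hmk := mem_connectedComponentIn (hmemℓ k)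
      have hml : γ (s l) ∈ connectedComponentIn (Set.range G ∩ ℓ) (γ (s k)) := by
        rw [heq]; exact mem_connectedComponentIn (hmemℓ l)
      rw [isPreconnected_closed_iff] at hpc
      have o1 : τ i ≤ τ (i + 1) := hτm _ _ (by omega) (by omega)
      have o2 : τ (i + 1) ≤ τ j := hτm _ _ (by omega) (by omega)
      have o3 : τ (j + 1) ≤ τ n := hτm _ _ (by omega) (by omega)
      have o4 : τ 0 ≤ τ i := hτm _ _ (by omega) (by omega)
      have o5 : τ (i + 1) < τ i + 1 := by
        have := (hτ1 (i + 1) (by omega)).2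
        have := (hτ1 i (by omega)).1
        linarith
      rw [hτn] at o3
      obtain ⟨p, hp, ⟨u, hu, hup⟩, v, hv, hvp⟩ := hpc (γ '' Set.Icc (τ i) (τ (i + 1)))
        (γ '' Set.Icc (τ (i + 1)) (τ i + 1))
        (isCompact_Icc.image hγ).isClosed (isCompact_Icc.image hγ).isClosed
        (by
          intro p hp
          obtain ⟨r, hr, rfl⟩ := hγs (τ i) p (hsub hp).1
          rcases le_total r (τ (i + 1)) with h' | h'
          · exact Or.inl ⟨r, ⟨hr.1, h'⟩, rfl⟩
          · exact Or.inr ⟨r, ⟨h', hr.2.le⟩, rfl⟩)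
        ⟨_, hmk, s k, hs k, rfl⟩
        ⟨_, hml, s l, ⟨by linarith [(hs l).1], by linarith [(hs l).2]⟩, rfl⟩
      have hpl : h p = 0 := by
        have := (hsub hp).2
        simp only [hℓ, Set.mem_ofPred_eq] at this
        simp only [h]
        linarith
      rcases hv.2.lt_or_eq with h' | h'
      · have huv := hγi (τ i) u v ⟨hu.1, by linarith [hu.2]⟩ ⟨by linarith [hv.1], h'⟩
          (hup.trans hvp.symm)
        have : u = τ (i + 1) := le_antisymm hu.2 (huv ▸ hv.1)
        rw [← hup, this] at hpl
        exact hneX (i + 1) (by omega) hpl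
      · rw [← hvp, h', hγp] at hpl
        exact hneX i (by omega) hpl
    have hne' : (e k : ZMod n).val ≠ (e l : ZMod n).val := by
      intro h'
      have := ZMod.val_injective n h'
      exact hkl (e.injective (Subtype.ext this))
    rcases lt_or_gt_of_ne hne' with hlt | hlt
    · exact main k l hlt heq
    · exact main l k hlt heq.symm

/-- Lemma 4.4. -/
theorem stmt_10 (X : Finset Pt) (n : ℕ) (hn : X.card = n) (hn3 : 3 ≤ n)
    (hgp : GenPos ↑X) (d : ℕ) (hd : 2 ≤ d)
    (J : Set Pt) (hJ : IsJordanCurve J) (hstab : StabLE J d)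
    (hXJ : (↑X : Set Pt) ⊆ J) :
    ∃ x : ZMod n → Pt, Function.Injective x ∧ (↑X : Set Pt) = Set.range x ∧
      IsJordanCurve (⋃ i : ZMod n, segment ℝ (x i) (x (i + 1))) ∧
      StabLE (⋃ i : ZMod n, segment ℝ (x i) (x (i + 1))) d := by
  have : NeZero n := ⟨by omega⟩
  obtain ⟨x₀, h1, h2, h3⟩ := exists_good X n hn d J hJ hstab hXJ
  obtain ⟨x, k1, k2, k3, k4⟩ := exists_simple n d hn3 X hgp x₀ h1 h2 h3
  exact ⟨x, k1, k2, poly_jordan n hn3 x k4 k1, stab_of_good n d hn3 X hgp x k1 k2 k3⟩
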